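/- arXiv:math/0301304 — 2 statements merged into one kernel-verified Lean document; each statement's English description precedes it below -/
import Mathlib

section
/- Let L be a finite field extension of ℚ_p. Then there exists a subfield F of L such that: F is of finite degree over ℚ with [F : ℚ] = [L : ℚ_p]; F is totally real (every field embedding F → ℂ has image contained in ℝ); and F·ℚ_p = L, i.e., the ℚ_p-subalgebra of L generated by F is all of L. -/
open Polynomial

theorem approx_rat (p : ℕ) [Fact p.Prime] (a : ℚ_[p]) (b : ℝ) {ε : ℝ} (hε : 0 < ε) :
    ∃ q : ℚ, ‖(q : ℚ_[p]) - a‖ < ε ∧ |(q : ℝ) - b| < ε := by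
  obtain ⟨q0, hq0⟩ := Padic.rat_dense p a hε
  have hp1 : 1 < (p : ℝ) := by exact_mod_cast (Fact.out : p.Prime).one_lt
  obtain ⟨k, hk⟩ := exists_pow_lt_of_lt_one hε (inv_lt_one_of_one_lt₀ hp1)
  have hpk : 0 < (p : ℝ) ^ k := by positivity
  obtain ⟨N, hN⟩ := exists_nat_gt ((p : ℝ) ^ k / ε)
  set M : ℕ := p * N + 1 with hM
  have hMN : (N : ℝ) < M := by
    rw [hM]; push_cast
    have : (0 : ℝ) ≤ N := by positivity
    nlinarith
  have hM0 : (0 : ℝ) < M := by positivity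
  set c : ℝ := (b - q0) / p ^ k with hc
  set m : ℤ := ⌊c * M⌋ with hm
  have hnM : ‖(M : ℚ_[p])‖ = 1 := by
    rw [Padic.norm_natCast_eq_one_iff]
    rw [hM]
    simp
  refine ⟨q0 + p ^ k * (m / M), ?_, ?_⟩
  · have h1 : ‖(p : ℚ_[p]) ^ k * (m / M)‖ < ε := by
      rw [norm_mul, norm_pow, norm_div, hnM, Padic.norm_p, div_one]
      refine lt_of_le_of_lt ?_ hk
      exact mul_le_of_le_one_right (by positivity) (Padic.norm_int_le_one m)
    have h2 : ((q0 + p ^ k * (m / M) : ℚ) : ℚ_[p]) - a = ((q0 : ℚ_[p]) - a) + (p : ℚ_[p]) ^ k * (m / M) := by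
      push_cast; ring
    rw [h2]
    refine lt_of_le_of_lt (Padic.nonarchimedean _ _) (max_lt ?_ h1)
    rwa [norm_sub_rev]
  · have h3 : ((q0 + p ^ k * (m / M) : ℚ) : ℝ) - b = - (p ^ k / M * (c * M - m)) := by
      have : b - q0 = c * p ^ k := by rw [hc]; field_simp
      push_cast
      field_simp
      linear_combination (-(M : ℝ)) * this
    rw [h3, abs_neg, abs_mul, abs_of_pos (by positivity)]
    have h4 : |c * M - m| ≤ 1 := by
      rw [abs_of_nonneg (by rw [hm]; linarith [Int.floor_le (c * M)])]
      rw [hm]; linarith [Int.lt_floor_add_one (c * M)]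
    have h5 : (p : ℝ) ^ k / M < ε := by
      rw [div_lt_iff₀ hM0]
      rw [div_lt_iff₀ hε] at hN
      nlinarith
    calc _ ≤ (p : ℝ) ^ k / M * 1 := by gcongr
      _ < ε := by simpa using h5

theorem approx_poly (p : ℕ) [Fact p.Prime] (f : ℚ_[p][X]) (h : ℝ[X]) (hf : f.Monic) (hh : h.Monic)
    (hd : h.natDegree = f.natDegree) {ε : ℝ} (hε : 0 < ε) :
    ∃ g : ℚ[X], g.Monic ∧ g.natDegree = f.natDegree ∧
      (∀ i, ‖(g.map (algebraMap ℚ ℚ_[p])).coeff i - f.coeff i‖ < ε) ∧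
      (∀ i, |(g.map (algebraMap ℚ ℝ)).coeff i - h.coeff i| < ε) := by
  choose c hc1 hc2 using fun i ↦ approx_rat p (f.coeff i) (h.coeff i) hε
  set n := f.natDegree with hn
  set r : ℚ[X] := ∑ i ∈ Finset.range n, C (c i) * X ^ i with hr
  have hrd : r.degree < n := by
    rw [hr]
    refine (degree_sum_le _ _).trans_lt ?_
    refine (Finset.sup_lt_iff (WithBot.bot_lt_coe n)).2 fun i hi ↦ ?_
    exact (degree_C_mul_X_pow_le _ _).trans_lt (WithBot.coe_lt_coe.2 (Finset.mem_range.1 hi))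
  have hco : ∀ i, r.coeff i = if i < n then c i else 0 := by
    intro i
    simp [hr, finsetSum_coeff, coeff_C_mul, coeff_X_pow]
  have hco2 : ∀ i, (X ^ n + r).coeff i = if i < n then c i else if i = n then 1 else 0 := by
    intro i
    rw [coeff_add, hco, coeff_X_pow]
    split_ifs <;> first | omega | simp
  refine ⟨X ^ n + r, monic_X_pow_add hrd, ?_, ?_, ?_⟩
  · rw [add_comm]; exact natDegree_eq_of_degree_eq_some (by rw [degree_add_eq_right_of_degree_lt (by simpa using hrd), degree_X_pow])
  · intro i
    rw [coeff_map, hco2]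
    split_ifs with h1 h2
    · simpa using hc1 i
    · subst h2; rw [hf.coeff_natDegree]; simpa using hε
    · rw [coeff_eq_zero_of_natDegree_lt (by omega)]; simpa using hε
  · intro i
    rw [coeff_map, hco2]
    split_ifs with h1 h2
    · simpa using hc2 i
    · subst h2; rw [← hd, hh.coeff_natDegree]; simpa using hε
    · rw [coeff_eq_zero_of_natDegree_lt (by omega)]; simpa using hε

theorem real_poly (n : ℕ) : ∃ h : ℝ[X], h.Monic ∧ h.natDegree = n ∧ ∃ δ > 0, ∀ g : ℝ[X], g.Monic →
    g.natDegree = n → (∀ i, |g.coeff i - h.coeff i| < δ) → g.Splits := by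
  set h : ℝ[X] := ∏ i ∈ Finset.range n, (X - C (i : ℝ)) with hh
  have hm : h.Monic := monic_prod_of_monic _ _ fun i _ ↦ monic_X_sub_C _
  have hd : h.natDegree = n := by
    rw [hh, natDegree_prod_of_monic _ _ fun i _ ↦ monic_X_sub_C _]
    simp only [natDegree_X_sub_C]; simp
  have hev : ∀ g : ℝ[X], g.natDegree = n → ∀ x, g.eval x = ∑ i : Fin (n + 1), g.coeff i * x ^ (i : ℕ) := by
    intro g hg x
    rw [eval_eq_sum_range, hg, Finset.sum_range]
  let G : (Fin (n + 1) → ℝ) → ℝ → ℝ := fun c x ↦ ∑ i, c i * x ^ (i : ℕ)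
  have hopen : IsOpen {c : Fin (n + 1) → ℝ | ∀ j : Fin n, G c (j - 1 / 2) * G c (j + 1 / 2) < 0} := by
    rw [Set.ofPred_forall]
    refine isOpen_iInter_of_finite fun j ↦ isOpen_lt ?_ continuous_const
    dsimp only [G]
    fun_prop
  have hmem : (fun i : Fin (n + 1) ↦ h.coeff i) ∈
      {c : Fin (n + 1) → ℝ | ∀ j : Fin n, G c (j - 1 / 2) * G c (j + 1 / 2) < 0} := by
    intro j
    dsimp only [G]
    rw [← hev h hd, ← hev h hd, hh, eval_prod, eval_prod, ← Finset.prod_mul_distrib,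
      ← Finset.mul_prod_erase _ _ (Finset.mem_range.2 j.2)]
    refine mul_neg_of_neg_of_pos (by simp) (Finset.prod_pos fun i hi ↦ ?_)
    have hij : i ≠ (j : ℕ) := (Finset.mem_erase.1 hi).1
    simp only [eval_sub, eval_X, eval_C]
    rcases lt_or_gt_of_ne hij with h1 | h1
    · have : (i : ℝ) + 1 ≤ (j : ℕ) := by exact_mod_cast h1
      apply mul_pos <;> linarith
    · have : ((j : ℕ) : ℝ) + 1 ≤ i := by exact_mod_cast h1
      apply mul_pos_of_neg_of_neg <;> linarith
  obtain ⟨δ, hδ, hball⟩ := Metric.isOpen_iff.1 hopen _ hmem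
  refine ⟨h, hm, hd, δ, hδ, fun g hgm hgd hg ↦ ?_⟩
  have hg' := hball (show (fun i : Fin (n + 1) ↦ g.coeff i) ∈ _ from by
    rw [Metric.mem_ball, dist_pi_lt_iff hδ]
    intro i
    rw [Real.dist_eq]
    exact hg i)
  have hroot : ∀ j : Fin n, ∃ x : ℝ, x ∈ Set.Ioo ((j : ℝ) - 1 / 2) (j + 1 / 2) ∧ g.eval x = 0 := by
    intro j
    have hj := hg' j
    dsimp only [G] at hj
    rw [← hev g hgd, ← hev g hgd] at hj
    have hle : (j : ℝ) - 1 / 2 ≤ j + 1 / 2 := by linarith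
    rcases mul_neg_iff.1 hj with ⟨h1, h2⟩ | ⟨h1, h2⟩
    · obtain ⟨x, hx, hx2⟩ := intermediate_value_Ioo' hle g.continuous.continuousOn ⟨h2, h1⟩
      exact ⟨x, hx, hx2⟩
    · obtain ⟨x, hx, hx2⟩ := intermediate_value_Ioo hle g.continuous.continuousOn ⟨h1, h2⟩
      exact ⟨x, hx, hx2⟩
  choose x hx hx0 using hroot
  have hinj : Function.Injective x := by
    intro i j hij
    by_contra hne
    have h1 := hx i
    have h2 := hx j
    rw [hij] at h1
    rcases lt_or_gt_of_ne (fun e ↦ hne (Fin.ext e) : (i : ℕ) ≠ j) with h | h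
    · have : ((i : ℕ) : ℝ) + 1 ≤ (j : ℕ) := by exact_mod_cast h
      linarith [h1.1, h1.2, h2.1, h2.2]
    · have : ((j : ℕ) : ℝ) + 1 ≤ (i : ℕ) := by exact_mod_cast h
      linarith [h1.1, h1.2, h2.1, h2.2]
  rw [splits_iff_card_roots]
  refine le_antisymm (card_roots' g) ?_
  have hsub : (Finset.univ.image x).val ≤ g.roots := by
    rw [Finset.val_le_iff_val_subset]
    intro y hy
    simp only [Finset.mem_val, Finset.mem_image, Finset.mem_univ, true_and] at hy
    obtain ⟨j, rfl⟩ := hy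
    exact (mem_roots hgm.ne_zero).2 (hx0 j)
  have := Multiset.card_le_card hsub
  rw [Finset.card_val, Finset.card_image_of_injective _ hinj] at this
  simpa [hgd] using this


open IntermediateField

theorem krasner_part (p : ℕ) [Fact p.Prime] (f : ℚ_[p][X]) (hf : f.Monic) (hirr : Irreducible f)
    (a : PadicAlgCl p) (fa0 : aeval a f = 0) :
    ∃ ε > 0, ∀ g : ℚ_[p][X], g.Monic → g.natDegree = f.natDegree →
      (∀ i, ‖g.coeff i - f.coeff i‖ < ε) →
        ∃ b : PadicAlgCl p, aeval b g = 0 ∧ a ∈ ℚ_[p]⟮b⟯ := by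
  have fnatdeg0 : f.natDegree ≠ 0 := (Irreducible.natDegree_pos hirr).ne'
  have hmin : f = minpoly ℚ_[p] a := minpoly.eq_of_irreducible_of_monic hirr fa0 hf
  obtain ⟨δ, δpos, hδ⟩ : ∃ δ > 0, ∀ a' : PadicAlgCl p, IsConjRoot ℚ_[p] a a' → a ≠ a' →
      δ ≤ ‖a - a'‖ := by
    have hfin : (f.rootSet (PadicAlgCl p) \ {a}).Finite :=
      (rootSet_finite f (PadicAlgCl p)).subset Set.sdiff_subset
    have hev : ∀ᶠ δ : ℝ in nhdsWithin 0 (Set.Ioi 0),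
        ∀ a' ∈ f.rootSet (PadicAlgCl p) \ {a}, δ < ‖a - a'‖ := by
      rw [hfin.eventually_all]
      intro a' ha'
      have : 0 < ‖a - a'‖ := by
        rw [norm_pos_iff, sub_ne_zero]
        exact fun h ↦ ha'.2 h.symm
      exact nhdsWithin_le_nhds (eventually_lt_nhds this)
    obtain ⟨δ, h1, h2⟩ := (hev.and self_mem_nhdsWithin).exists
    refine ⟨δ, h2, fun a' hc hne ↦ (h1 a' ⟨?_, fun h ↦ hne h.symm⟩).le⟩
    rw [hmin]
    exact (isConjRoot_iff_mem_minpoly_rootSet ⟨f, hf, fa0⟩).1 hc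
  have hε : (δ / (max ‖a‖ 1)) ^ f.natDegree / (f.natDegree + 1) > 0 := by positivity
  refine ⟨_, hε, fun g gmon gdeg gcoeff ↦ ?_⟩
  let ⟨b, hb, hab⟩ := exists_aroots_norm_sub_lt_of_norm_coeff_sub_lt
      hε fa0 hf gmon gdeg gcoeff (IsAlgClosed.splits _)
  have hab : ‖a - b‖ < δ := by
    rw [← Real.rpow_natCast, ← mul_comm_div, div_self, one_mul,
        ← Real.rpow_mul (div_pos δpos (by positivity)).le, mul_inv_cancel₀] at hab
    · simpa [mul_assoc, div_mul_cancel₀ _ (by positivity : (max ‖a‖ 1) > 0).ne'] using hab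
    · simp [fnatdeg0]
    · positivity
  have hb0 : aeval b g = 0 := (mem_aroots.1 hb).2
  refine ⟨b, hb0, ?_⟩
  exact IsKrasner.krasner (minpoly.irreducible ⟨f, hf, fa0⟩).separable
    (IsAlgClosed.splits _) ⟨g, gmon, hb0⟩ fun a' h1 h2 ↦ lt_of_lt_of_le hab (hδ a' h1 h2)

theorem exists_beta (p : ℕ) [Fact p.Prime] (L : Type*) [Field L] [Algebra ℚ_[p] L]
    [FiniteDimensional ℚ_[p] L] : ∃ (g : ℚ[X]) (β : L), g.Monic ∧
      (g.map (algebraMap ℚ ℝ)).Splits ∧ Irreducible g ∧ g.natDegree = Module.finrank ℚ_[p] L ∧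
      aeval β (g.map (algebraMap ℚ ℚ_[p])) = 0 ∧ ℚ_[p]⟮β⟯ = ⊤ := by
  obtain ⟨α, hα⟩ := Field.exists_primitive_element ℚ_[p] L
  have hint : IsIntegral ℚ_[p] α := Algebra.IsIntegral.isIntegral α
  set f := minpoly ℚ_[p] α with hfdef
  have hf : f.Monic := minpoly.monic hint
  have hirr : Irreducible f := minpoly.irreducible hint
  have hfd : f.natDegree = Module.finrank ℚ_[p] L := by
    rw [hfdef, ← adjoin.finrank hint, hα, finrank_top']
  let iL : L →ₐ[ℚ_[p]] PadicAlgCl p := IsAlgClosed.lift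
  have fa0 : aeval (iL α) f = 0 := by
    rw [aeval_algHom_apply, minpoly.aeval, map_zero]
  obtain ⟨ε, hε, H⟩ := krasner_part p f hf hirr (iL α) fa0
  obtain ⟨h, hh, hhd, δ, hδ, HR⟩ := real_poly f.natDegree
  obtain ⟨g, gm, gd, g1, g2⟩ := approx_poly p f h hf hh hhd (lt_min hε hδ)
  have gmp : (g.map (algebraMap ℚ ℚ_[p])).Monic := gm.map _
  have gdp : (g.map (algebraMap ℚ ℚ_[p])).natDegree = f.natDegree := by rw [natDegree_map, gd]
  obtain ⟨b, hb0, hab⟩ := H _ gmp gdp fun i ↦ (g1 i).trans_le (min_le_left _ _)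
  have bint : IsIntegral ℚ_[p] b := ⟨_, gmp, hb0⟩
  have hle : ℚ_[p]⟮iL α⟯ ≤ ℚ_[p]⟮b⟯ := by simpa using hab
  have hfa : f = minpoly ℚ_[p] (iL α) := minpoly.eq_of_irreducible_of_monic hirr fa0 hf
  have aint : IsIntegral ℚ_[p] (iL α) := ⟨f, hf, fa0⟩
  have hdvd : minpoly ℚ_[p] b ∣ g.map (algebraMap ℚ ℚ_[p]) := minpoly.dvd _ _ hb0
  have hnd : (minpoly ℚ_[p] b).natDegree ≤ f.natDegree := by
    rw [← gdp]; exact natDegree_le_of_dvd hdvd gmp.ne_zero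
  have := IntermediateField.adjoin.finiteDimensional bint
  have heq : ℚ_[p]⟮iL α⟯ = ℚ_[p]⟮b⟯ := by
    refine IntermediateField.eq_of_le_of_finrank_le hle ?_
    rw [adjoin.finrank bint, adjoin.finrank aint, ← hfa]
    exact hnd
  have hbd : (minpoly ℚ_[p] b).natDegree = f.natDegree := by
    rw [← adjoin.finrank bint, ← heq, adjoin.finrank aint, ← hfa]
  have hgb : minpoly ℚ_[p] b = g.map (algebraMap ℚ ℚ_[p]) :=
    (eq_of_monic_of_dvd_of_natDegree_le (minpoly.monic bint) gmp hdvd (by rw [hbd, gdp])).symm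
  have hbr : b ∈ iL.fieldRange := by
    have : b ∈ ℚ_[p]⟮iL α⟯ := heq ▸ mem_adjoin_simple_self _ b
    refine (adjoin_simple_le_iff.2 ?_ : ℚ_[p]⟮iL α⟯ ≤ iL.fieldRange) this
    exact ⟨α, rfl⟩
  obtain ⟨β, rfl⟩ := hbr
  change iL α ∈ ℚ_[p]⟮iL β⟯ at hab
  change aeval (iL β) _ = 0 at hb0
  refine ⟨g, β, gm, ?_, ?_, gd.trans hfd, ?_, ?_⟩
  · exact HR _ (gm.map _) (by rw [natDegree_map, gd]) fun i ↦ (g2 i).trans_le (min_le_right _ _)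
  · refine gm.irreducible_of_irreducible_map (algebraMap ℚ ℚ_[p]) _ ?_
    rw [← hgb]
    exact minpoly.irreducible bint
  · apply iL.injective
    rw [map_zero, ← hb0]
    exact (aeval_algHom_apply iL β _).symm
  · rw [← top_le_iff, ← hα, adjoin_simple_le_iff]
    simpa [← Set.image_singleton, ← IntermediateField.adjoin_map] using! hab

/-- For every finite extension `L` of `ℚ_p` there is a subfield `F ⊆ L`,
totally real and of finite degree over `ℚ` equal to `[L : ℚ_p]`, with `F·ℚ_p = L`. -/
theorem stmt_14 (p : ℕ) [Fact p.Prime] (L : Type*) [Field L] [Algebra ℚ_[p] L]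
    [FiniteDimensional ℚ_[p] L] :
    ∃ F : Subfield L,
      haveI : CharZero L := charZero_of_injective_algebraMap (algebraMap ℚ_[p] L).injective
      FiniteDimensional ℚ F ∧
      Module.finrank ℚ F = Module.finrank ℚ_[p] L ∧
      (∀ φ : F →+* ℂ, ∀ x : F, (φ x).im = 0) ∧
      Algebra.adjoin ℚ_[p] (F : Set L) = ⊤ := by
  obtain ⟨g, β, gm, gs, girr, gd, gβ, htop⟩ := exists_beta p L
  have hcz : CharZero L := charZero_of_injective_algebraMap (algebraMap ℚ_[p] L).injective
  have gβ' : aeval β g = 0 := by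
    rw [← gβ, aeval_map_algebraMap]
  have βint : IsIntegral ℚ β := ⟨g, gm, gβ'⟩
  have hmin : g = minpoly ℚ β := minpoly.eq_of_irreducible_of_monic girr gβ' gm
  refine ⟨(ℚ⟮β⟯).toSubfield, ?_, ?_, ?_, ?_⟩
  · exact IntermediateField.adjoin.finiteDimensional βint
  · rw [← gd, hmin]
    exact adjoin.finrank βint
  · intro φ x
    have hx : (x : L) ∈ ℚ⟮β⟯ := x.2
    let b : (ℚ⟮β⟯).toSubfield := ⟨β, mem_adjoin_simple_self ℚ β⟩
    obtain ⟨q, hq⟩ : ∃ q : ℚ[X], (x : L) = aeval β q := by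
      rw [← IntermediateField.mem_toSubalgebra,
        adjoin_simple_toSubalgebra_of_isAlgebraic βint.isAlgebraic, Algebra.adjoin_singleton_eq_range_aeval] at hx
      obtain ⟨q, hq⟩ := hx
      exact ⟨q, hq.symm⟩
    have hsub : ∀ q : ℚ[X], ((eval₂ (Rat.castHom _) b q : (ℚ⟮β⟯).toSubfield) : L) = aeval β q := by
      intro q
      change (ℚ⟮β⟯).toSubfield.subtype _ = _
      rw [hom_eval₂, aeval_def]
      congr 1
    have hx' : x = eval₂ (Rat.castHom _) b q := Subtype.ext (by rw [hsub, hq])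
    have hb0 : eval₂ (Rat.castHom _) b g = 0 := Subtype.ext (by rw [hsub, gβ']; rfl)
    have hφ : ∀ q : ℚ[X], φ (eval₂ (Rat.castHom _) b q) = aeval (φ b) q := by
      intro q
      rw [hom_eval₂, aeval_def]
      congr 1
      exact Subsingleton.elim _ _
    have h0 : aeval (φ b) g = 0 := by rw [← hφ, hb0, map_zero]
    obtain ⟨r, hr⟩ : ∃ r : ℝ, (r : ℂ) = φ b := by
      have h1 : aeval (φ b) (g.map (algebraMap ℚ ℝ)) = 0 := by
        rw [aeval_map_algebraMap, h0]
      have h2 : ((g.map (algebraMap ℚ ℝ)).map (algebraMap ℝ ℂ)).IsRoot (φ b) := by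
        rwa [IsRoot.def, eval_map_algebraMap]
      exact gs.mem_range_of_isRoot (gm.map _).ne_zero h2
    rw [hx', hφ, ← hr]
    have : aeval (r : ℂ) q = ((aeval r q : ℝ) : ℂ) := aeval_algebraMap_apply ℂ r q
    rw [this, Complex.ofReal_im]
  · rw [← top_le_iff]
    have h1 : Algebra.adjoin ℚ_[p] {β} = ⊤ := by
      rw [← adjoin_simple_toSubalgebra_of_isAlgebraic
        (Algebra.IsAlgebraic.isAlgebraic (R := ℚ_[p]) β), htop, top_toSubalgebra]
    rw [← h1]
    refine Algebra.adjoin_mono ?_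
    intro y hy
    rw [Set.mem_singleton_iff.1 hy]
    exact mem_adjoin_simple_self ℚ β
end

section
/- Let (A_n, u_n)_{n∈ℕ} and (B_n, v_n)_{n∈ℕ} be inverse systems of abelian groups and let (f_n : A_n → B_n)_{n∈ℕ} be a morphism of inverse systems (f_n ∘ u_{n+1} = v_{n+1} ∘ f_{n+1} for all n) such that the cokernel of each f_n is finite. Then the induced homomorphism lim¹ A_n → lim¹ B_n is surjective. -/
/-- The homomorphism `∏ₙ Aₙ → ∏ₙ Aₙ`, `(aₙ)ₙ ↦ (aₙ - uₙ₊₁(aₙ₊₁))ₙ`, whose kernel and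
cokernel are `lim Aₙ` and `lim¹ Aₙ` respectively. -/
def shiftHom {A : ℕ → Type*} [∀ n, AddCommGroup (A n)] (u : ∀ n, A (n + 1) →+ A n) :
    (∀ n, A n) →+ (∀ n, A n) :=
  AddMonoidHom.mk' (fun a n => a n - u n (a (n + 1))) (by
    intro a b
    funext n
    simp only [Pi.add_apply, map_add]
    abel)

theorem exists_compat {X : ℕ → Type*} [∀ n, Finite (X n)] [∀ n, Nonempty (X n)]
    (φ : ∀ n, X (n + 1) → X n) : ∃ x : ∀ n, X n, ∀ n, φ n (x (n + 1)) = x n := by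
  let F : CategoryTheory.Functor ℕᵒᵖ (Type _) := CategoryTheory.Functor.ofOpSequence (X := X)
    (fun n => TypeCat.ofHom (φ n))
  haveI : ∀ j, Finite (F.obj j) := fun j => inferInstanceAs (Finite (X j.unop))
  haveI : ∀ j, Nonempty (F.obj j) := fun j => inferInstanceAs (Nonempty (X j.unop))
  obtain ⟨s, hs⟩ := nonempty_sections_of_finite_cofiltered_system F
  refine ⟨fun n => s (Opposite.op n), fun n => ?_⟩
  have h := hs (CategoryTheory.homOfLE (Nat.le_add_right n 1)).op
  have e : F.map (CategoryTheory.homOfLE (Nat.le_add_right n 1)).op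
      = TypeCat.ofHom (φ n) :=
    CategoryTheory.Functor.ofOpSequence_map_homOfLE_succ _ n
  rw [e] at h
  exact h

/-- A morphism `(fₙ) : (Aₙ, uₙ) → (Bₙ, vₙ)` of inverse systems of abelian
groups with finite cokernels induces a surjection `lim¹ Aₙ → lim¹ Bₙ`. -/
theorem stmt_19 (A B : ℕ → Type*) [∀ n, AddCommGroup (A n)] [∀ n, AddCommGroup (B n)]
    (u : ∀ n, A (n + 1) →+ A n) (v : ∀ n, B (n + 1) →+ B n)
    (f : ∀ n, A n →+ B n)
    (hcomm : ∀ n x, f n (u n x) = v n (f (n + 1) x))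
    (hfin : ∀ n, Finite (B n ⧸ (f n).range)) :
    Function.Surjective
      (QuotientAddGroup.map (shiftHom u).range (shiftHom v).range
        (AddMonoidHom.mk' (fun a n => f n (a n)) (by
          intro a b; funext n; simp))
        (by
          rintro x ⟨a, rfl⟩
          refine ⟨fun n => f n (a n), ?_⟩
          funext n
          simp [shiftHom, map_sub, hcomm])) := by
  intro q
  obtain ⟨b, rfl⟩ := QuotientAddGroup.mk_surjective q
  let w : ∀ n, B (n + 1) ⧸ (f (n + 1)).range →+ B n ⧸ (f n).range := fun n =>
    QuotientAddGroup.map _ _ (v n) (by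
      rintro _ ⟨a, rfl⟩
      exact ⟨u n a, hcomm n a⟩)
  obtain ⟨x, hx⟩ := exists_compat (X := fun n => B n ⧸ (f n).range)
    (fun n y => (b n : B n ⧸ (f n).range) + w n y)
  choose c hc using fun n => QuotientAddGroup.mk_surjective (x n)
  have key : ∀ n, ∃ a, f n a = b n - (c n - v n (c (n + 1))) := by
    intro n
    have h := hx n
    rw [← hc n, ← hc (n + 1)] at h
    have h2 : ((b n + v n (c (n + 1)) : B n) : B n ⧸ (f n).range) = (c n : B n) := h
    obtain ⟨a, ha⟩ := QuotientAddGroup.eq.mp h2.symm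
    exact ⟨a, by rw [ha]; abel⟩
  choose a ha using key
  refine ⟨QuotientAddGroup.mk a, ?_⟩
  refine QuotientAddGroup.eq.mpr ⟨c, ?_⟩
  funext n
  change c n - v n (c (n + 1)) = - f n (a n) + b n
  rw [ha]; abel
end
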